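/- arXiv:0809.4269 — 2 statements merged into one kernel-verified Lean document; each statement's English description precedes it below -/
import Mathlib

section
/- For any contravariant metric g and any three densities ρ₁, ρ₂, ρ₃ on U, the two-cocycle condition ν(ρ₁; ρ₂, g) + ν(ρ₂; ρ₃, g) + ν(ρ₃; ρ₁, g) = 0 holds pointwise on U, where ν(ρ′; ρ, g) := √(ρ/ρ′)·Δ_ρ(√(ρ′/ρ)). -/
/-- The `A`-th partial derivative of a function `f : ℝⁿ → ℝ`. -/
noncomputable def pd {n : ℕ} (A : Fin n) (f : (Fin n → ℝ) → ℝ) (z : Fin n → ℝ) : ℝ :=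
  fderiv ℝ f z (Pi.single A 1)

/-- The Laplacian `Δ_ρ f := (1/ρ)·Σ_{A,B} ∂_A(ρ g^{AB} ∂_B f)` associated to a density `ρ`
and a contravariant metric `g`. -/
noncomputable def lap {n : ℕ} (ρ : (Fin n → ℝ) → ℝ) (g : (Fin n → ℝ) → Fin n → Fin n → ℝ)
    (f : (Fin n → ℝ) → ℝ) (z : Fin n → ℝ) : ℝ :=
  (ρ z)⁻¹ * ∑ A, ∑ B, pd A (fun w => ρ w * g w A B * pd B f w) z

/-- The two-cocycle `ν(ρ′; ρ, g) := √(ρ/ρ′)·Δ_ρ(√(ρ′/ρ))`. -/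
noncomputable def nuCocycle {n : ℕ} (ρ' ρ : (Fin n → ℝ) → ℝ)
    (g : (Fin n → ℝ) → Fin n → Fin n → ℝ) (z : Fin n → ℝ) : ℝ :=
  Real.sqrt (ρ z / ρ' z) * lap ρ g (fun w => Real.sqrt (ρ' w / ρ w)) z

theorem pd_congr {n : ℕ} {f h : (Fin n → ℝ) → ℝ} {U : Set (Fin n → ℝ)} (hU : IsOpen U)
    (hfh : ∀ w ∈ U, f w = h w) {z : Fin n → ℝ} (hz : z ∈ U) (A : Fin n) :
    pd A f z = pd A h z := by
  have : f =ᶠ[nhds z] h := Filter.eventuallyEq_of_mem (hU.mem_nhds hz) hfh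
  rw [pd, pd, this.fderiv_eq]

theorem pd_mul {n : ℕ} {f h : (Fin n → ℝ) → ℝ} {z : Fin n → ℝ}
    (hf : DifferentiableAt ℝ f z) (hh : DifferentiableAt ℝ h z) (A : Fin n) :
    pd A (fun w => f w * h w) z = f z * pd A h z + h z * pd A f z := by
  simp [pd, fderiv_fun_mul hf hh]

theorem pd_sub {n : ℕ} {f h : (Fin n → ℝ) → ℝ} {z : Fin n → ℝ}
    (hf : DifferentiableAt ℝ f z) (hh : DifferentiableAt ℝ h z) (A : Fin n) :
    pd A (fun w => f w - h w) z = pd A f z - pd A h z := by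
  simp [pd, fderiv_fun_sub hf hh]

/-- The quotient rule, cleared of denominators. -/
theorem sq_mul_pd_div {n : ℕ} {f h : (Fin n → ℝ) → ℝ} {z : Fin n → ℝ}
    (hf : DifferentiableAt ℝ f z) (hh : DifferentiableAt ℝ h z) (hz : h z ≠ 0) (A : Fin n) :
    h z ^ 2 * pd A (fun w => f w / h w) z = h z * pd A f z - f z * pd A h z := by
  have hnhds : ∀ᶠ w in nhds z, f w = h w * (f w / h w) := by
    filter_upwards [hh.continuousAt.eventually_ne hz] with w hw
    field_simp
  have hdiv : DifferentiableAt ℝ (fun w => f w / h w) z := by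
    simpa only [div_eq_mul_inv] using hf.fun_mul (hh.fun_inv hz)
  have hmul := pd_mul hh hdiv A
  have hcongr : pd A f z = pd A (fun w => h w * (f w / h w)) z := by
    rw [pd, pd, Filter.EventuallyEq.fderiv_eq hnhds]
  rw [hcongr, hmul]
  field_simp
  ring

theorem contDiffOn_pd {n : ℕ} {f : (Fin n → ℝ) → ℝ} {U : Set (Fin n → ℝ)} (hU : IsOpen U)
    (hf : ContDiffOn ℝ (⊤ : ℕ∞) f U) (A : Fin n) : ContDiffOn ℝ (⊤ : ℕ∞) (pd A f) U :=
  (hf.fderiv_of_isOpen hU (by simp)).clm_apply contDiffOn_const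

/-- The coboundary form of the cocycle: with `D f = Σ ∂_A(g^{AB} ∂_B f)`, it is the difference of
`D √ρ′ / √ρ′` and `D √ρ / √ρ`. -/
theorem nuCocycle_eq_sub {n : ℕ} {U : Set (Fin n → ℝ)} (hU : IsOpen U)
    {g : (Fin n → ℝ) → Fin n → Fin n → ℝ}
    (hg : ∀ A B, ContDiffOn ℝ (⊤ : ℕ∞) (fun z => g z A B) U)
    (hgsymm : ∀ z ∈ U, ∀ A B, g z A B = g z B A)
    {ρ' ρ : (Fin n → ℝ) → ℝ}
    (hρ' : ContDiffOn ℝ (⊤ : ℕ∞) ρ' U) (hρ'pos : ∀ z ∈ U, 0 < ρ' z)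
    (hρ : ContDiffOn ℝ (⊤ : ℕ∞) ρ U) (hρpos : ∀ z ∈ U, 0 < ρ z)
    {z : Fin n → ℝ} (hz : z ∈ U) :
    nuCocycle ρ' ρ g z =
      (∑ A, ∑ B, pd A (fun w => g w A B * pd B (fun x => √(ρ' x)) w) z) / √(ρ' z) -
        (∑ A, ∑ B, pd A (fun w => g w A B * pd B (fun x => √(ρ x)) w) z) / √(ρ z) := by
  set s' : (Fin n → ℝ) → ℝ := fun x => √(ρ' x)
  set s : (Fin n → ℝ) → ℝ := fun x => √(ρ x)
  have hs'C : ContDiffOn ℝ (⊤ : ℕ∞) s' U := hρ'.sqrt fun x hx => (hρ'pos x hx).ne'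
  have hsC : ContDiffOn ℝ (⊤ : ℕ∞) s U := hρ.sqrt fun x hx => (hρpos x hx).ne'
  have hs'pos : ∀ x ∈ U, 0 < s' x := fun x hx => Real.sqrt_pos.2 (hρ'pos x hx)
  have hspos : ∀ x ∈ U, 0 < s x := fun x hx => Real.sqrt_pos.2 (hρpos x hx)
  have hdiff : ∀ {f : (Fin n → ℝ) → ℝ}, ContDiffOn ℝ (⊤ : ℕ∞) f U → ∀ x ∈ U,
      DifferentiableAt ℝ f x := fun hf x hx =>
    (hf.differentiableOn (by simp)).differentiableAt (hU.mem_nhds hx)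
  have hflux : ∀ A B, ∀ w ∈ U, ρ w * g w A B * pd B (fun x => √(ρ' x / ρ x)) w =
      s w * (g w A B * pd B s' w) - s' w * (g w A B * pd B s w) := by
    intro A B w hw
    have hquot := pd_congr hU (f := fun x => √(ρ' x / ρ x)) (h := fun x => s' x / s x)
      (fun x hx => Real.sqrt_div (hρ'pos x hx).le _) hw B
    have hsq : ρ w = s w ^ 2 := (Real.sq_sqrt (hρpos w hw).le).symm
    rw [hquot, hsq]
    linear_combination g w A B *
      sq_mul_pd_div (hdiff hs'C w hw) (hdiff hsC w hw) (hspos w hw).ne' B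
  have hterm : ∀ A B, pd A (fun w => ρ w * g w A B * pd B (fun x => √(ρ' x / ρ x)) w) z =
      s z * pd A (fun w => g w A B * pd B s' w) z - s' z * pd A (fun w => g w A B * pd B s w) z
        + (g z A B * pd A s z * pd B s' z - g z A B * pd B s z * pd A s' z) := by
    intro A B
    have hgs' := hdiff ((hg A B).mul (contDiffOn_pd hU hs'C B)) z hz
    have hgs := hdiff ((hg A B).mul (contDiffOn_pd hU hsC B)) z hz
    have ds := hdiff hsC z hz
    have ds' := hdiff hs'C z hz
    rw [pd_congr hU (hflux A B) hz A, pd_sub (ds.fun_mul hgs') (ds'.fun_mul hgs),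
      pd_mul ds hgs', pd_mul ds' hgs]
    ring
  have hcross : ∑ A, ∑ B, g z A B * pd A s z * pd B s' z =
      ∑ A, ∑ B, g z A B * pd B s z * pd A s' z := by
    rw [Finset.sum_comm]
    refine Finset.sum_congr rfl fun A _ => Finset.sum_congr rfl fun B _ => ?_
    rw [hgsymm z hz B A]
  have hsq : ρ z = s z ^ 2 := (Real.sq_sqrt (hρpos z hz).le).symm
  have hsqrt : √(ρ z / ρ' z) = s z / s' z := Real.sqrt_div (hρpos z hz).le _
  have hsz := (hspos z hz).ne'
  have hs'z := (hs'pos z hz).ne'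
  change _ = _ / s' z - _ / s z
  rw [nuCocycle, lap, hsqrt, hsq]
  simp only [hterm, Finset.sum_add_distrib, Finset.sum_sub_distrib, ← Finset.mul_sum, hcross,
    sub_self, add_zero]
  field_simp

/-- for any contravariant metric `g` and any three densities `ρ₁, ρ₂, ρ₃` on `U`,
the two-cocycle condition `ν(ρ₁; ρ₂, g) + ν(ρ₂; ρ₃, g) + ν(ρ₃; ρ₁, g) = 0` holds
pointwise on `U`. -/
theorem stmt1 {n : ℕ} (U : Set (Fin n → ℝ)) (hU : IsOpen U)
    (g : (Fin n → ℝ) → Fin n → Fin n → ℝ)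
    (hg : ∀ A B, ContDiffOn ℝ (⊤ : ℕ∞) (fun z => g z A B) U)
    (hgsymm : ∀ z ∈ U, ∀ A B, g z A B = g z B A)
    (ρ₁ ρ₂ ρ₃ : (Fin n → ℝ) → ℝ)
    (hρ₁ : ContDiffOn ℝ (⊤ : ℕ∞) ρ₁ U) (hρ₁pos : ∀ z ∈ U, 0 < ρ₁ z)
    (hρ₂ : ContDiffOn ℝ (⊤ : ℕ∞) ρ₂ U) (hρ₂pos : ∀ z ∈ U, 0 < ρ₂ z)
    (hρ₃ : ContDiffOn ℝ (⊤ : ℕ∞) ρ₃ U) (hρ₃pos : ∀ z ∈ U, 0 < ρ₃ z) :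
    ∀ z ∈ U,
      nuCocycle ρ₁ ρ₂ g z + nuCocycle ρ₂ ρ₃ g z + nuCocycle ρ₃ ρ₁ g z = 0 := by
  intro z hz
  rw [nuCocycle_eq_sub hU hg hgsymm hρ₁ hρ₁pos hρ₂ hρ₂pos hz,
    nuCocycle_eq_sub hU hg hgsymm hρ₂ hρ₂pos hρ₃ hρ₃pos hz,
    nuCocycle_eq_sub hU hg hgsymm hρ₃ hρ₃pos hρ₁ hρ₁pos hz]
  ring
end

section
/- The spin curvature is the vielbein conjugate of the curvature of the connection: with ω^b{}_{Ac} := Σ_{B,C} (e^b{}_B Γ^B{}_{AC} − ∂_A e^b{}_C)·e^C{}_c, define R^{(ω)d}{}_{ABc} := ∂_A ω^d{}_{Bc} − ∂_B ω^d{}_{Ac} + Σ_e (ω^d{}_{Ae} ω^e{}_{Bc} − ω^d{}_{Be} ω^e{}_{Ac}) and R^{(Γ)D}{}_{ABC} := ∂_A Γ^D{}_{BC} − ∂_B Γ^D{}_{AC} + Σ_E (Γ^D{}_{AE} Γ^E{}_{BC} − Γ^D{}_{BE} Γ^E{}_{AC}); then R^{(ω)d}{}_{ABc} = Σ_{D,C}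 e^d{}_D · R^{(Γ)D}{}_{ABC} · e^C{}_c pointwise on U. -/
/-- The spin connection determined by a vielbein `e` (with pointwise inverse `eInv`) and a
connection `Γ`:  `ω^b{}_{Ac} := Σ_{B,C} e^b{}_B Γ^B{}_{AC} e^C{}_c − Σ_C (∂_A e^b{}_C)·e^C{}_c`. -/
noncomputable def spinConn {n : ℕ} (e eInv : (Fin n → ℝ) → Fin n → Fin n → ℝ)
    (Γ : (Fin n → ℝ) → Fin n → Fin n → Fin n → ℝ)
    (b A c : Fin n) (z : Fin n → ℝ) : ℝ :=
  (∑ B, ∑ C, e z b B * Γ z B A C * eInv z C c)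
    - ∑ C, pd A (fun w => e w b C) z * eInv z C c

/-- The Riemann curvature of a connection `Γ^A{}_{BC}`. -/
noncomputable def riemConn {n : ℕ} (Γ : (Fin n → ℝ) → Fin n → Fin n → Fin n → ℝ)
    (D A B C : Fin n) (z : Fin n → ℝ) : ℝ :=
  pd A (fun w => Γ w D B C) z - pd B (fun w => Γ w D A C) z
    + ∑ E, (Γ z D A E * Γ z E B C - Γ z D B E * Γ z E A C)

/-- The spin curvature of the spin connection `ω`:
`R^{(ω)d}{}_{ABc} := ∂_A ω^d{}_{Bc} − ∂_B ω^d{}_{Ac} + Σ_e (ω^d{}_{Ae}ω^e{}_{Bc} − ω^d{}_{Be}ω^e{}_{Ac})`. -/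
noncomputable def spinCurv {n : ℕ} (e eInv : (Fin n → ℝ) → Fin n → Fin n → ℝ)
    (Γ : (Fin n → ℝ) → Fin n → Fin n → Fin n → ℝ)
    (d A B c : Fin n) (z : Fin n → ℝ) : ℝ :=
  pd A (fun w => spinConn e eInv Γ d B c w) z - pd B (fun w => spinConn e eInv Γ d A c w) z
    + ∑ e', (spinConn e eInv Γ d A e' z * spinConn e eInv Γ e' B c z
             - spinConn e eInv Γ d B e' z * spinConn e eInv Γ e' A c z)

/-- The entrywise partial derivative of a matrix-valued function. -/
noncomputable def matrixPd {n : ℕ} (A : Fin n) (M : (Fin n → ℝ) → Matrix (Fin n) (Fin n) ℝ)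
    (z : Fin n → ℝ) : Matrix (Fin n) (Fin n) ℝ :=
  Matrix.of fun i j => pd A (fun w => M w i j) z

theorem Filter.EventuallyEq.pd_eq {n : ℕ} {A : Fin n} {f g : (Fin n → ℝ) → ℝ} {z : Fin n → ℝ}
    (h : f =ᶠ[nhds z] g) : pd A f z = pd A g z := by
  rw [pd, pd, h.fderiv_eq]

theorem matrixPd_congr {n : ℕ} {A : Fin n} {M N : (Fin n → ℝ) → Matrix (Fin n) (Fin n) ℝ}
    {z : Fin n → ℝ} (h : M =ᶠ[nhds z] N) : matrixPd A M z = matrixPd A N z := by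
  ext i j
  exact Filter.EventuallyEq.pd_eq (h.mono fun w hw => congrFun (congrFun hw i) j)

theorem matrixPd_sub {n : ℕ} (A : Fin n) {M N : (Fin n → ℝ) → Matrix (Fin n) (Fin n) ℝ}
    {z : Fin n → ℝ} (hM : ∀ i j, DifferentiableAt ℝ (fun w => M w i j) z)
    (hN : ∀ i j, DifferentiableAt ℝ (fun w => N w i j) z) :
    matrixPd A (fun w => M w - N w) z = matrixPd A M z - matrixPd A N z := by
  ext i j
  simp only [matrixPd, Matrix.of_apply, Matrix.sub_apply, pd]
  rw [fderiv_fun_sub (hM i j) (hN i j)]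
  rfl

theorem matrixPd_mul {n : ℕ} (A : Fin n) {M N : (Fin n → ℝ) → Matrix (Fin n) (Fin n) ℝ}
    {z : Fin n → ℝ} (hM : ∀ i j, DifferentiableAt ℝ (fun w => M w i j) z)
    (hN : ∀ i j, DifferentiableAt ℝ (fun w => N w i j) z) :
    matrixPd A (fun w => M w * N w) z = matrixPd A M z * N z + M z * matrixPd A N z := by
  ext i j
  simp only [matrixPd, Matrix.of_apply, Matrix.add_apply, Matrix.mul_apply, pd]
  rw [fderiv_fun_sum fun k _ => (hM i k).fun_mul (hN k j), ← Finset.sum_add_distrib,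
    sum_apply]
  refine Finset.sum_congr rfl fun k _ => ?_
  rw [fderiv_fun_mul (hM i k) (hN k j)]
  simp only [add_apply, smul_apply, smul_eq_mul]
  ring

theorem DifferentiableAt.matrix_mul_apply {n : ℕ}
    {M N : (Fin n → ℝ) → Matrix (Fin n) (Fin n) ℝ}
    {z : Fin n → ℝ} (hM : ∀ i j, DifferentiableAt ℝ (fun w => M w i j) z)
    (hN : ∀ i j, DifferentiableAt ℝ (fun w => N w i j) z) (i j : Fin n) :
    DifferentiableAt ℝ (fun w => (M w * N w) i j) z := by
  simp only [Matrix.mul_apply]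
  exact DifferentiableAt.fun_sum fun k _ => (hM i k).mul (hN k j)

theorem DifferentiableAt.matrix_det {n : ℕ} {M : (Fin n → ℝ) → Matrix (Fin n) (Fin n) ℝ}
    {z : Fin n → ℝ} (hM : ∀ i j, DifferentiableAt ℝ (fun w => M w i j) z) :
    DifferentiableAt ℝ (fun w => (M w).det) z := by
  simp only [Matrix.det_apply']
  exact DifferentiableAt.fun_sum fun σ _ =>
    (HasFDerivAt.finsetProd fun i _ => (hM (σ i) i).hasFDerivAt).differentiableAt.const_mul _

theorem DifferentiableAt.matrix_inv_apply {n : ℕ}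
    {M : (Fin n → ℝ) → Matrix (Fin n) (Fin n) ℝ}
    {z : Fin n → ℝ} (hM : ∀ i j, DifferentiableAt ℝ (fun w => M w i j) z)
    (hz : (M z).det ≠ 0) (i j : Fin n) :
    DifferentiableAt ℝ (fun w => (M w)⁻¹ i j) z := by
  simp only [Matrix.inv_def, Ring.inverse_eq_inv', Matrix.smul_apply, smul_eq_mul,
    Matrix.adjugate_apply]
  refine ((DifferentiableAt.matrix_det hM).inv hz).mul (DifferentiableAt.matrix_det fun k l => ?_)
  by_cases h : k = j
  · subst h
    simp
  · simpa [Matrix.updateRow_ne h] using hM k l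

theorem ContDiffAt.differentiableAt_pd {n : ℕ} {f : (Fin n → ℝ) → ℝ} {z : Fin n → ℝ}
    (hf : ContDiffAt ℝ 2 f z) (A : Fin n) : DifferentiableAt ℝ (pd A f) z :=
  ((hf.fderiv_right (m := 1) (by norm_num)).differentiableAt (by norm_num)).clm_apply
    (differentiableAt_const _)

theorem ContDiffAt.pd_comm {n : ℕ} {f : (Fin n → ℝ) → ℝ} {z : Fin n → ℝ}
    (hf : ContDiffAt ℝ 2 f z) (A B : Fin n) : pd A (pd B f) z = pd B (pd A f) z := by
  have hd : DifferentiableAt ℝ (fderiv ℝ f) z :=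
    (hf.fderiv_right (m := 1) (by norm_num)).differentiableAt (by norm_num)
  have key (A B : Fin n) : pd A (pd B f) z
      = fderiv ℝ (fderiv ℝ f) z (Pi.single A 1) (Pi.single B 1) := by
    change fderiv ℝ (fun w => fderiv ℝ f w (Pi.single B 1)) z (Pi.single A 1) = _
    rw [fderiv_clm_apply hd (differentiableAt_const _)]
    simp
  rw [key, key]
  exact (hf.isSymmSndFDerivAt (by simp)).eq _ _

/-- The curvature of the gauge transform `(M G_A - ∂_A M) M⁻¹` is the conjugate of the curvature. -/
theorem gauge_curvature {n : ℕ} {M : (Fin n → ℝ) → Matrix (Fin n) (Fin n) ℝ}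
    {W G : Fin n → (Fin n → ℝ) → Matrix (Fin n) (Fin n) ℝ} {z : Fin n → ℝ}
    (hM : ∀ i j, ContDiffAt ℝ 2 (fun w => M w i j) z)
    (hG : ∀ A i j, DifferentiableAt ℝ (fun w => G A w i j) z)
    (hW : ∀ A i j, DifferentiableAt ℝ (fun w => W A w i j) z)
    (h : ∀ᶠ w in nhds z, ∀ A, W A w * M w = M w * G A w - matrixPd A M w) (A B : Fin n) :
    (matrixPd A (W B) z - matrixPd B (W A) z + (W A z * W B z - W B z * W A z)) * M z
      = M z * (matrixPd A (G B) z - matrixPd B (G A) z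
          + (G A z * G B z - G B z * G A z)) := by
  have hMd (i j) : DifferentiableAt ℝ (fun w => M w i j) z :=
    (hM i j).differentiableAt (by norm_num)
  have hderiv (A B : Fin n) : matrixPd A (W B) z * M z + W B z * matrixPd A M z
      = matrixPd A M z * G B z + M z * matrixPd A (G B) z - matrixPd A (matrixPd B M) z := by
    rw [← matrixPd_mul A (hW B) hMd, ← matrixPd_mul A hMd (hG B), ← matrixPd_sub A
      (N := matrixPd B M) (DifferentiableAt.matrix_mul_apply hMd (hG B))
      fun i j => (hM i j).differentiableAt_pd B]
    exact matrixPd_congr (h.mono fun w hw => hw B)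
  have hcomm : matrixPd A (matrixPd B M) z = matrixPd B (matrixPd A M) z := by
    ext i j
    exact (hM i j).pd_comm A B
  have hAB := hderiv A B
  have hBA := hderiv B A
  have hz := h.self_of_nhds
  rw [hcomm] at hAB
  have hA : matrixPd A (W B) z * M z = matrixPd A M z * G B z + M z * matrixPd A (G B) z
      - matrixPd B (matrixPd A M) z - W B z * matrixPd A M z := eq_sub_of_add_eq hAB
  have hB : matrixPd B (W A) z * M z = matrixPd B M z * G A z + M z * matrixPd B (G A) z
      - matrixPd B (matrixPd A M) z - W A z * matrixPd B M z := eq_sub_of_add_eq hBA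
  have hWW (A B : Fin n) : W A z * W B z * M z
      = M z * G A z * G B z - matrixPd A M z * G B z - W A z * matrixPd B M z := by
    rw [mul_assoc, hz B, mul_sub, ← mul_assoc, hz A, sub_mul]
  rw [add_mul, sub_mul, sub_mul, hA, hB, hWW A B, hWW B A]
  noncomm_ring

/-- the spin curvature is the vielbein conjugate of the curvature of the
connection: `R^{(ω)d}{}_{ABc} = Σ_{D,C} e^d{}_D · R^{(Γ)D}{}_{ABC} · e^C{}_c` pointwise on `U`. -/
theorem stmt11 {n : ℕ} (U : Set (Fin n → ℝ)) (hU : IsOpen U)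
    (e eInv : (Fin n → ℝ) → Fin n → Fin n → ℝ)
    (he : ∀ a A, ContDiffOn ℝ (⊤ : ℕ∞) (fun z => e z a A) U)
    (heInv : ∀ z ∈ U, ∀ a b, ∑ A, e z a A * eInv z A b = if a = b then 1 else 0)
    (heInv' : ∀ z ∈ U, ∀ A B, ∑ a, eInv z A a * e z a B = if A = B then 1 else 0)
    (Γ : (Fin n → ℝ) → Fin n → Fin n → Fin n → ℝ)
    (hΓ : ∀ A B C, ContDiffOn ℝ (⊤ : ℕ∞) (fun z => Γ z A B C) U) :
    ∀ z ∈ U, ∀ d A B c,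
      spinCurv e eInv Γ d A B c z
        = ∑ D, ∑ C, e z d D * riemConn Γ D A B C z * eInv z C c := by
  intro z hz d A B c
  let M : (Fin n → ℝ) → Matrix (Fin n) (Fin n) ℝ := fun w => Matrix.of (e w)
  let N : (Fin n → ℝ) → Matrix (Fin n) (Fin n) ℝ := fun w => Matrix.of (eInv w)
  let G : Fin n → (Fin n → ℝ) → Matrix (Fin n) (Fin n) ℝ :=
    fun A w => Matrix.of fun D C => Γ w D A C
  let W : Fin n → (Fin n → ℝ) → Matrix (Fin n) (Fin n) ℝ :=
    fun A w => Matrix.of fun b c => spinConn e eInv Γ b A c w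
  have hU' : U ∈ nhds z := hU.mem_nhds hz
  have hMN (w) (hw : w ∈ U) : M w * N w = 1 := by
    ext a b
    simpa [M, N, Matrix.mul_apply, Matrix.one_apply] using heInv w hw a b
  have hNM (w) (hw : w ∈ U) : N w * M w = 1 := by
    ext a b
    simpa [M, N, Matrix.mul_apply, Matrix.one_apply] using heInv' w hw a b
  have hM (i j) : ContDiffAt ℝ 2 (fun w => M w i j) z :=
    ((he i j).contDiffAt hU').of_le (WithTop.coe_le_coe.2 (le_top (a := (2 : ℕ∞))))
  have hMd (i j) : DifferentiableAt ℝ (fun w => M w i j) z :=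
    (hM i j).differentiableAt (by norm_num)
  have hG (A i j) : DifferentiableAt ℝ (fun w => G A w i j) z :=
    ((hΓ i A j).contDiffAt hU').differentiableAt (by simp)
  have hN (i j) : DifferentiableAt ℝ (fun w => N w i j) z := by
    refine (DifferentiableAt.matrix_inv_apply hMd ?_ i j).congr_of_eventuallyEq ?_
    · exact ((Matrix.isUnit_iff_isUnit_det _).1 (.of_mul_eq_one _ (hMN z hz))).ne_zero
    · filter_upwards [hU'] with w hw
      rw [Matrix.inv_eq_right_inv (hMN w hw)]
  have hWeq (A w) : W A w = (M w * G A w - matrixPd A M w) * N w := by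
    ext b c
    simp only [W, spinConn, M, N, G, matrixPd, sub_mul, Matrix.of_apply, Matrix.sub_apply,
      Matrix.mul_apply, Finset.sum_mul, Finset.sum_sub_distrib]
    rw [Finset.sum_comm]
  have hW (A i j) : DifferentiableAt ℝ (fun w => W A w i j) z := by
    simp only [hWeq]
    exact DifferentiableAt.matrix_mul_apply (fun i j =>
      (DifferentiableAt.matrix_mul_apply hMd (hG A) i j).sub ((hM i j).differentiableAt_pd A)) hN i j
  have key := gauge_curvature hM hG hW (by
    filter_upwards [hU'] with w hw A
    rw [hWeq, mul_assoc, hNM w hw, mul_one]) A B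
  replace key := congrArg (· * N z) key
  simp only [mul_assoc _ (M z) (N z), hMN z hz, mul_one] at key
  have hdc := congrFun (congrFun key d) c
  have hL : spinCurv e eInv Γ d A B c z
      = (matrixPd A (W B) z - matrixPd B (W A) z + (W A z * W B z - W B z * W A z)) d c := by
    simp only [spinCurv, W, matrixPd, Matrix.of_apply, Matrix.sub_apply, Matrix.add_apply,
      Matrix.mul_apply, Finset.sum_sub_distrib]
  have hR (D C) : (matrixPd A (G B) z - matrixPd B (G A) z + (G A z * G B z - G B z * G A z)) D C
      = riemConn Γ D A B C z := by
    simp only [riemConn, G, matrixPd, Matrix.of_apply, Matrix.sub_apply, Matrix.add_apply,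
      Matrix.mul_apply, Finset.sum_sub_distrib]
  rw [hL, hdc, Matrix.mul_apply, Finset.sum_comm]
  refine Finset.sum_congr rfl fun C _ => ?_
  rw [Matrix.mul_apply, Finset.sum_mul]
  simp only [hR, M, N, Matrix.of_apply]
end
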